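/- Let 0 < ε < 1 and 0 < δ < 1, let A, B be nonzero real d×n matrices, and let r̃ = max{‖A‖_F²/‖A‖², ‖B‖_F²/‖B‖²} be the maximum stable rank. There exists an absolute constant C > 0 such that if k ≥ C·(r̃ + log(1/δ))/ε², then with probability at least 1−δ over the random sketching matrix Π, ‖(ΠA)^T(ΠB) − A^T B‖ ≤ ε·‖A‖·‖B‖ in spectral norm. -/

import Mathlib

open MeasureTheory ProbabilityTheory Matrix
open scoped NNReal ENNReal

noncomputable def cnorm {d n : ℕ} (A : Matrix (Fin d) (Fin n) ℝ) (i : Fin n) : ℝ :=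
  Real.sqrt (∑ r, (A r i) ^ 2)

noncomputable def frobNorm {d n : ℕ} (A : Matrix (Fin d) (Fin n) ℝ) : ℝ :=
  Real.sqrt (∑ r, ∑ i, (A r i) ^ 2)

noncomputable def specNorm {m n : ℕ} (A : Matrix (Fin m) (Fin n) ℝ) : ℝ :=
  ‖LinearMap.toContinuousLinearMap (Matrix.toEuclideanLin A)‖

/-- The distribution of a k×d random matrix with i.i.d. N(0, 1/k) entries. -/
noncomputable def gaussianMatrix (k d : ℕ) : Measure (Fin k → Fin d → ℝ) :=
  Measure.pi fun _ : Fin k => Measure.pi fun _ : Fin d => gaussianReal 0 (k : ℝ≥0)⁻¹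

/-- The rescaled-JL estimator M̃(i,j) = ‖A_i‖·‖B_j‖·(Ã_i^T B̃_j)/(‖Ã_i‖·‖B̃_j‖),
where Ã = ΠA and B̃ = ΠB. -/
noncomputable def rescaledJL {k d n : ℕ} (P : Fin k → Fin d → ℝ)
    (A B : Matrix (Fin d) (Fin n) ℝ) : Matrix (Fin n) (Fin n) ℝ :=
  Matrix.of fun i j =>
    cnorm A i * cnorm B j * (((Matrix.of P * A)ᵀ * (Matrix.of P * B)) i j) /
      (cnorm (Matrix.of P * A) i * cnorm (Matrix.of P * B) j)


/-- The centred Gaussian measure on `Fin n → ℝ` with covariance `v • 1`. -/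
noncomputable def isoGaussian (n : ℕ) (v : ℝ≥0) : Measure (Fin n → ℝ) :=
  Measure.pi fun _ : Fin n => gaussianReal 0 v

instance (n : ℕ) (v : ℝ≥0) : IsProbabilityMeasure (isoGaussian n v) := by
  unfold isoGaussian; infer_instance

instance (k d : ℕ) : IsProbabilityMeasure (gaussianMatrix k d) := by
  unfold gaussianMatrix; infer_instance

lemma lintegral_pi_prod {ι : Type*} [Fintype ι] {X : ι → Type*} [∀ i, MeasurableSpace (X i)]
    (μ : (i : ι) → Measure (X i)) [∀ i, IsProbabilityMeasure (μ i)] {f : (i : ι) → X i → ℝ≥0∞}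
    (hf : ∀ i, Measurable (f i)) :
    ∫⁻ x, ∏ i, f i (x i) ∂Measure.pi μ = ∏ i, ∫⁻ y, f i y ∂μ i := by
  refine (lintegral_prod_eq_prod_lintegral_of_indepFun (μ := Measure.pi μ) Finset.univ
    (fun i (x : ∀ j, X j) => f i (x i))
    (iIndepFun_pi fun i => (hf i).aemeasurable)
    fun i => (hf i).comp (measurable_pi_apply i)).trans ?_
  exact Finset.prod_congr rfl fun i _ => lintegral_map (hf i) (measurable_pi_apply i) |>.symm.trans
    (by rw [(measurePreserving_eval μ i).map_eq])

lemma pi_withDensity {ι : Type*} [Fintype ι] {X : ι → Type*} [∀ i, MeasurableSpace (X i)]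
    (μ : (i : ι) → Measure (X i)) [∀ i, IsProbabilityMeasure (μ i)] {f : (i : ι) → X i → ℝ≥0∞}
    (hf : ∀ i, Measurable (f i)) [∀ i, SigmaFinite ((μ i).withDensity (f i))] :
    Measure.pi (fun i => (μ i).withDensity (f i))
      = (Measure.pi μ).withDensity fun x => ∏ i, f i (x i) := by
  refine Measure.pi_eq fun s hs => ?_
  rw [withDensity_apply _ (MeasurableSet.univ_pi hs), ← lintegral_indicator (MeasurableSet.univ_pi hs)]
  have h : ((Set.univ.pi s).indicator fun x => ∏ i, f i (x i))
      = fun x => ∏ i, (s i).indicator (f i) (x i) := by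
    ext x
    by_cases hx : x ∈ Set.univ.pi s
    · rw [Set.indicator_of_mem hx]
      exact Finset.prod_congr rfl fun i _ => (Set.indicator_of_mem (hx i trivial) _).symm
    · rw [Set.indicator_of_notMem hx]
      simp only [Set.mem_pi, not_forall] at hx
      obtain ⟨i, _, hi⟩ := hx
      exact (Finset.prod_eq_zero (Finset.mem_univ i) (Set.indicator_of_notMem hi _)).symm
  rw [h, lintegral_pi_prod μ fun i => (hf i).indicator (hs i)]
  exact Finset.prod_congr rfl fun i _ => by
    rw [lintegral_indicator (hs i), withDensity_apply _ (hs i)]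

lemma gaussianReal_eq_withDensity (m : ℝ) {v : ℝ≥0} (hv : v ≠ 0) :
    gaussianReal m v = (gaussianReal 0 v).withDensity
      fun x => ENNReal.ofReal (Real.exp ((m * x - m ^ 2 / 2) / v)) := by
  rw [gaussianReal_of_var_ne_zero _ hv, gaussianReal_of_var_ne_zero _ hv,
    ← withDensity_mul _ (measurable_gaussianPDF 0 v) (by fun_prop)]
  congr 1
  ext x
  have hv' : (v : ℝ) ≠ 0 := by exact_mod_cast hv
  simp only [gaussianPDF, gaussianPDFReal, Pi.mul_apply]
  rw [← ENNReal.ofReal_mul (by positivity), mul_assoc (√_)⁻¹, ← Real.exp_add]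
  congr 3
  field_simp
  ring

lemma isoGaussian_eq_map (n : ℕ) {v : ℝ≥0} (hv : v ≠ 0) (u : Fin n → ℝ) :
    isoGaussian n v = ((isoGaussian n v).withDensity fun x =>
      ENNReal.ofReal (Real.exp (-(u ⬝ᵥ x + u ⬝ᵥ u / 2) / v))).map (fun x => x + u) := by
  have h1 : isoGaussian n v
      = (Measure.pi fun i => gaussianReal (-u i) v).map (fun x i => x i + u i) := by
    rw [Measure.pi_map_pi (f := fun i (x : ℝ) => x + u i) (fun i => by fun_prop)]
    simp [gaussianReal_map_add_const, isoGaussian]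
  have h2 : (Measure.pi fun i => gaussianReal (-u i) v) = (isoGaussian n v).withDensity fun x =>
      ENNReal.ofReal (Real.exp (-(u ⬝ᵥ x + u ⬝ᵥ u / 2) / v)) := by
    have h3 := fun i => gaussianReal_eq_withDensity (-u i) hv
    have : ∀ i, SigmaFinite ((gaussianReal 0 v).withDensity
      fun x => ENNReal.ofReal (Real.exp ((-u i * x - (-u i) ^ 2 / 2) / v))) := fun i => by
        rw [← h3]; infer_instance
    simp_rw [h3]
    rw [pi_withDensity _ (fun i => by fun_prop)]
    unfold isoGaussian
    congr 1
    ext x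
    rw [← ENNReal.ofReal_prod_of_nonneg (fun i _ => (Real.exp_pos _).le), ← Real.exp_sum]
    congr 2
    simp only [dotProduct, Finset.sum_div, ← Finset.sum_add_distrib, ← Finset.sum_neg_distrib]
    exact Finset.sum_congr rfl fun i _ => by ring
  rw [← h2]
  exact h1

lemma measurable_dotProduct_left {n : ℕ} (z : Fin n → ℝ) :
    Measurable fun x : Fin n → ℝ => z ⬝ᵥ x := by
  unfold dotProduct; fun_prop

lemma isoGaussian_map_neg (n : ℕ) (v : ℝ≥0) :
    (isoGaussian n v).map (fun x => -x) = isoGaussian n v := by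
  unfold isoGaussian
  have := Measure.pi_map_pi (μ := fun _ : Fin n => gaussianReal 0 v)
    (f := fun i (x : ℝ) => -x) (fun i => by fun_prop)
  simp only [gaussianReal_map_neg, neg_zero] at this
  exact this

lemma isoGaussian_map_dotProduct (n : ℕ) (v : ℝ≥0) (z : Fin n → ℝ) :
    (isoGaussian n v).map (fun x => z ⬝ᵥ x) = gaussianReal 0 ((z ⬝ᵥ z).toNNReal * v) := by
  have hz : 0 ≤ z ⬝ᵥ z := Finset.sum_nonneg fun i _ => mul_self_nonneg _
  have hm := measurable_dotProduct_left z
  have := Measure.isProbabilityMeasure_map (μ := isoGaussian n v) hm.aemeasurable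
  refine Measure.ext_of_charFun ?_
  ext t
  rw [charFun_apply_real, charFun_gaussianReal, integral_map hm.aemeasurable (by fun_prop)]
  have h : ∀ x : Fin n → ℝ, Complex.exp (t * ((z ⬝ᵥ x : ℝ) : ℂ) * Complex.I)
      = ∏ i, Complex.exp ((t * z i : ℝ) * (x i : ℂ) * Complex.I) := fun x => by
    rw [← Complex.exp_sum]
    congr 1
    simp only [dotProduct, Complex.ofReal_sum, Finset.mul_sum, Finset.sum_mul]
    exact Finset.sum_congr rfl fun i _ => by push_cast; ring
  simp_rw [h]
  unfold isoGaussian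
  rw [integral_fintype_prod_eq_prod (f := fun i (x : ℝ) =>
    Complex.exp ((t * z i : ℝ) * (x : ℂ) * Complex.I))]
  simp_rw [← charFun_apply_real, charFun_gaussianReal]
  rw [← Complex.exp_sum]
  congr 1
  have : (((z ⬝ᵥ z).toNNReal * v : ℝ≥0) : ℝ) = (z ⬝ᵥ z) * v := by
    rw [NNReal.coe_mul, Real.coe_toNNReal _ hz]
  rw [← Complex.ofReal_inj] at this
  simp only [NNReal.coe_mul] at *
  simp only [Complex.ofReal_zero, mul_zero, zero_mul, zero_sub, this]
  rw [Finset.sum_neg_distrib]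
  congr 1
  simp only [dotProduct, Complex.ofReal_sum, Complex.ofReal_mul, Finset.sum_mul, Finset.sum_div]
  exact Finset.sum_congr rfl fun i _ => by ring

lemma lintegral_sq_dotProduct (n : ℕ) (v : ℝ≥0) (z : Fin n → ℝ) :
    ∫⁻ x, ENNReal.ofReal ((z ⬝ᵥ x) ^ 2) ∂isoGaussian n v = ENNReal.ofReal (z ⬝ᵥ z * v) := by
  have hz : 0 ≤ z ⬝ᵥ z := Finset.sum_nonneg fun i _ => mul_self_nonneg _
  have hm := measurable_dotProduct_left z
  rw [← lintegral_map (f := fun y : ℝ => ENNReal.ofReal (y ^ 2)) (by fun_prop) hm,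
    isoGaussian_map_dotProduct]
  have hL := memLp_id_gaussianReal (μ := 0) (v := (z ⬝ᵥ z).toNNReal * v) 2
  rw [← ofReal_integral_eq_lintegral_ofReal (by simpa using hL.integrable_sq)
    (by filter_upwards with x using sq_nonneg x)]
  congr 1
  have := variance_id_gaussianReal (μ := 0) (v := (z ⬝ᵥ z).toNNReal * v)
  rw [variance_of_integral_eq_zero (by fun_prop) (by simp)] at this
  simpa [hz] using this

lemma lintegral_exp_sq_gaussianReal (w : ℝ≥0) (a : ℝ) (ha : |a| * w ≤ 1 / 10) :
    ∫⁻ x, ENNReal.ofReal (Real.exp (a * (x ^ 2 - w))) ∂gaussianReal 0 w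
      ≤ ENNReal.ofReal (Real.exp (4 * (a * w) ^ 2)) := by
  rcases eq_or_ne w 0 with rfl | hw
  · simp
  have hw0 : (0 : ℝ) < w := by positivity
  have ht : |a * w| ≤ 1 / 10 := by rwa [abs_mul, abs_of_pos hw0]
  obtain ⟨ht1, ht2⟩ := abs_le.1 ht
  have hpos : 0 < 1 - 2 * (a * w) := by linarith
  set w' : ℝ≥0 := ⟨w / (1 - 2 * (a * w)), by positivity⟩ with hw'
  have hw'c : (w' : ℝ) = w / (1 - 2 * (a * w)) := rfl
  have hw'0 : w' ≠ 0 := by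
    rw [← NNReal.coe_ne_zero, hw'c]; positivity
  rw [gaussianReal_of_var_ne_zero _ hw,
    lintegral_withDensity_eq_lintegral_mul _ (measurable_gaussianPDF 0 w) (by fun_prop)]
  have key : ∀ x : ℝ, (gaussianPDF 0 w * fun x : ℝ => ENNReal.ofReal (Real.exp (a * (x ^ 2 - w)))) x
      = ENNReal.ofReal (Real.exp (-(a * w)) * √(1 / (1 - 2 * (a * w)))) * gaussianPDF 0 w' x := by
    intro x
    simp only [Pi.mul_apply, gaussianPDF, gaussianPDFReal, sub_zero, hw'c]
    rw [← ENNReal.ofReal_mul (by positivity), ← ENNReal.ofReal_mul (by positivity)]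
    congr 1
    have e1 : √(2 * Real.pi * (w / (1 - 2 * (a * w)))) =
      √(2 * Real.pi * w) * √(1 / (1 - 2 * (a * w))) := by
      rw [← Real.sqrt_mul (by positivity)]; congr 1; ring
    have e2 : Real.exp (-x ^ 2 / (2 * w)) * Real.exp (a * (x ^ 2 - w)) =
        Real.exp (-(a * w)) * Real.exp (-x ^ 2 / (2 * (w / (1 - 2 * (a * w))))) := by
      rw [← Real.exp_add, ← Real.exp_add]
      congr 1
      field_simp
      ring
    have e3 : √(1 / (1 - 2 * (a * w))) ≠ 0 := by positivity
    have e4 : √(2 * Real.pi * w) ≠ 0 := by positivity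
    rw [e1, mul_assoc, e2]
    generalize √(1 / (1 - 2 * (a * w))) = s at e3
    field_simp
  simp_rw [key]
  rw [lintegral_const_mul _ (measurable_gaussianPDF 0 w'), lintegral_gaussianPDF_eq_one 0 hw'0, mul_one]
  apply ENNReal.ofReal_le_ofReal
  set t := a * w
  have h5 : Real.exp (-(2 * t + 8 * t ^ 2)) ≤ 1 - 2 * t := by
    have := (abs_le.1 (Real.abs_exp_sub_one_sub_id_le (x := -(2 * t + 8 * t ^ 2))
      (abs_le.2 ⟨by nlinarith, by nlinarith⟩))).2
    have h6 : (1 + 4 * t) ^ 2 ≤ 2 := by nlinarith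
    nlinarith [mul_le_mul_of_nonneg_left h6 (sq_nonneg t)]
  have h7 : √(1 / (1 - 2 * t)) ≤ Real.exp (t + 4 * t ^ 2) := by
    apply Real.sqrt_le_iff.2 ⟨(Real.exp_pos _).le, ?_⟩
    rw [div_le_iff₀ hpos, ← Real.exp_nat_mul]
    calc 1 = Real.exp ((2 : ℕ) * (t + 4 * t ^ 2)) * Real.exp (-(2 * t + 8 * t ^ 2)) := by
          rw [← Real.exp_add, Real.exp_eq_one_iff _ |>.2]; push_cast; ring
      _ ≤ _ := by gcongr
  calc _ ≤ Real.exp (-t) * Real.exp (t + 4 * t ^ 2) := by gcongr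
    _ = _ := by rw [← Real.exp_add]; congr 1; ring

lemma le_lintegral_exp_of_symmetric (n : ℕ) (v : ℝ≥0) {G : Set (Fin n → ℝ)} (hG : MeasurableSet G)
    (hneg : ∀ x, -x ∈ G ↔ x ∈ G) (l : Fin n → ℝ) :
    isoGaussian n v G ≤ ∫⁻ x in G, ENNReal.ofReal (Real.exp (l ⬝ᵥ x)) ∂isoGaussian n v := by
  have hm := measurable_dotProduct_left l
  have hf : Measurable fun x : Fin n → ℝ => ENNReal.ofReal (Real.exp (l ⬝ᵥ x)) := by fun_prop
  have hsym : ∫⁻ x in G, ENNReal.ofReal (Real.exp (l ⬝ᵥ (-x))) ∂isoGaussian n v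
      = ∫⁻ x in G, ENNReal.ofReal (Real.exp (l ⬝ᵥ x)) ∂isoGaussian n v := by
    rw [← lintegral_indicator hG, ← lintegral_indicator hG]
    conv_rhs => rw [← isoGaussian_map_neg n v, lintegral_map (hf.indicator hG) (by fun_prop)]
    refine lintegral_congr fun x => ?_
    by_cases hx : x ∈ G
    · rw [Set.indicator_of_mem hx, Set.indicator_of_mem ((hneg x).2 hx)]
    · rw [Set.indicator_of_notMem hx, Set.indicator_of_notMem (mt (hneg x).1 hx)]
  have h2 : 2 * isoGaussian n v G
      ≤ 2 * ∫⁻ x in G, ENNReal.ofReal (Real.exp (l ⬝ᵥ x)) ∂isoGaussian n v := by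
    rw [two_mul (∫⁻ x in G, _ ∂_)]
    nth_rewrite 2 [← hsym]
    rw [← lintegral_add_left hf, ← setLIntegral_const]
    refine lintegral_mono fun x => ?_
    rw [← ENNReal.ofReal_add (Real.exp_pos _).le (Real.exp_pos _).le, dotProduct_neg]
    rw [show (2 : ℝ≥0∞) = ENNReal.ofReal 2 by simp]
    apply ENNReal.ofReal_le_ofReal
    have := Real.add_one_le_exp (l ⬝ᵥ x)
    have := Real.add_one_le_exp (-(l ⬝ᵥ x))
    linarith
  exact (ENNReal.mul_le_mul_iff_right (by simp) (by simp)).1 h2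

lemma le_lintegral_exp_of_shift (n : ℕ) {v : ℝ≥0} (hv : v ≠ 0) {G S : Set (Fin n → ℝ)}
    (hG : MeasurableSet G) (hS : MeasurableSet S) (hneg : ∀ x, -x ∈ G ↔ x ∈ G) (u : Fin n → ℝ)
    (hGS : ∀ x ∈ G, x + u ∈ S) (w : Fin n → ℝ) :
    isoGaussian n v G * ENNReal.ofReal (Real.exp (w ⬝ᵥ u - u ⬝ᵥ u / (2 * v)))
      ≤ ∫⁻ x in S, ENNReal.ofReal (Real.exp (w ⬝ᵥ x)) ∂isoGaussian n v := by
  have hmw := measurable_dotProduct_left w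
  have hmu := measurable_dotProduct_left u
  have hml := measurable_dotProduct_left (w - (v : ℝ)⁻¹ • u)
  have hf : Measurable fun x : Fin n → ℝ => ENNReal.ofReal (Real.exp (w ⬝ᵥ x)) := by fun_prop
  have hv' : (v : ℝ) ≠ 0 := by exact_mod_cast hv
  rw [← lintegral_indicator hS, isoGaussian_eq_map n hv u,
    lintegral_map (hf.indicator hS) (by fun_prop), ← isoGaussian_eq_map n hv u,
    lintegral_withDensity_eq_lintegral_mul _ (by fun_prop)
      ((hf.indicator hS).fun_comp (measurable_add_const u))]
  calc _ ≤ (∫⁻ x in G, ENNReal.ofReal (Real.exp ((w - (v : ℝ)⁻¹ • u) ⬝ᵥ x)) ∂isoGaussian n v)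
        * ENNReal.ofReal (Real.exp (w ⬝ᵥ u - u ⬝ᵥ u / (2 * v))) := by
        gcongr
        exact le_lintegral_exp_of_symmetric n v hG hneg _
    _ ≤ _ := by
        rw [← lintegral_mul_const _ (by fun_prop), ← lintegral_indicator hG]
        refine lintegral_mono fun x => ?_
        by_cases hx : x ∈ G
        · simp only [Set.indicator_of_mem hx, Pi.mul_apply, Set.indicator_of_mem (hGS x hx)]
          rw [← ENNReal.ofReal_mul (Real.exp_pos _).le, ← ENNReal.ofReal_mul (Real.exp_pos _).le,
            ← Real.exp_add, ← Real.exp_add]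
          apply le_of_eq
          congr 2
          simp only [sub_dotProduct, smul_dotProduct, dotProduct_add, smul_eq_mul]
          field_simp
          ring
        · simp [Set.indicator_of_notMem hx]

lemma measurable_mulVec_normSq {d n : ℕ} (A : Matrix (Fin d) (Fin n) ℝ) :
    Measurable fun x : Fin n → ℝ => A *ᵥ x ⬝ᵥ A *ᵥ x := by
  unfold Matrix.mulVec dotProduct; fun_prop

lemma isoGaussian_mulVec_le {d n : ℕ} {v : ℝ≥0} (A : Matrix (Fin d) (Fin n) ℝ)
    (hA : (∑ i, ∑ j, A i j ^ 2) * v ≤ 1) :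
    ENNReal.ofReal (3 / 4) ≤ isoGaussian n v {x | A *ᵥ x ⬝ᵥ A *ᵥ x ≤ 4} := by
  have hG : MeasurableSet {x : Fin n → ℝ | A *ᵥ x ⬝ᵥ A *ᵥ x ≤ 4} :=
    measurableSet_le (measurable_mulVec_normSq A) measurable_const
  have hsecond : ∫⁻ x, ENNReal.ofReal (A *ᵥ x ⬝ᵥ A *ᵥ x) ∂isoGaussian n v ≤ 1 := by
    have : ∀ x : Fin n → ℝ, ENNReal.ofReal (A *ᵥ x ⬝ᵥ A *ᵥ x)
        = ∑ i, ENNReal.ofReal (((fun j => A i j) ⬝ᵥ x) ^ 2) := fun x => by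
      rw [← ENNReal.ofReal_sum_of_nonneg fun i _ => sq_nonneg _]
      congr 1
      exact Finset.sum_congr rfl fun i _ => (sq _).symm
    simp_rw [this]
    rw [lintegral_finsetSum _ fun i _ => by
      have := measurable_dotProduct_left fun j => A i j
      fun_prop]
    simp_rw [lintegral_sq_dotProduct]
    simp only [dotProduct, ← sq]
    refine (ENNReal.ofReal_sum_of_nonneg (f := fun i => (∑ j, A i j ^ 2) * (v : ℝ)) fun i _ =>
      mul_nonneg (Finset.sum_nonneg fun j _ => sq_nonneg _) v.coe_nonneg).symm.trans_le ?_
    rw [← Finset.sum_mul, ENNReal.ofReal_le_one]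
    exact hA
  have hc : isoGaussian n v {x | A *ᵥ x ⬝ᵥ A *ᵥ x ≤ 4}ᶜ ≤ ENNReal.ofReal (1 / 4) := by
    have h4 := mul_meas_ge_le_lintegral (μ := isoGaussian n v)
      (f := fun x : Fin n → ℝ => ENNReal.ofReal (A *ᵥ x ⬝ᵥ A *ᵥ x))
      (measurable_mulVec_normSq A).ennreal_ofReal (ENNReal.ofReal 4)
    have h5 : isoGaussian n v {x | A *ᵥ x ⬝ᵥ A *ᵥ x ≤ 4}ᶜ ≤ isoGaussian n v
        {x | ENNReal.ofReal 4 ≤ ENNReal.ofReal (A *ᵥ x ⬝ᵥ A *ᵥ x)} :=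
      measure_mono fun x hx => ENNReal.ofReal_le_ofReal (not_le.1 (Set.notMem_ofPred_iff.1 hx)).le
    have h6 : ENNReal.ofReal 4 * isoGaussian n v {x | A *ᵥ x ⬝ᵥ A *ᵥ x ≤ 4}ᶜ
        ≤ ENNReal.ofReal 4 * ENNReal.ofReal (1 / 4) := by
      rw [← ENNReal.ofReal_mul (by norm_num), show (4 : ℝ) * (1 / 4) = 1 by norm_num, ENNReal.ofReal_one]
      exact (mul_le_mul_right h5 _).trans (h4.trans hsecond)
    exact (ENNReal.mul_le_mul_iff_right (by simp) (by simp)).1 h6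
  rw [prob_compl_eq_one_sub hG, tsub_le_iff_right] at hc
  have h7 : ENNReal.ofReal (3 / 4) + ENNReal.ofReal (1 / 4) ≤
      ENNReal.ofReal (1 / 4) + isoGaussian n v {x | A *ᵥ x ⬝ᵥ A *ᵥ x ≤ 4} := by
    rw [← ENNReal.ofReal_add (by norm_num) (by norm_num)]
    norm_num at hc ⊢
    exact hc
  rw [add_comm] at h7
  exact (ENNReal.add_le_add_iff_left (by simp)).1 h7

lemma lintegral_exp_mul_dotProduct_le {d : ℕ} {v : ℝ≥0} {x y : Fin d → ℝ} (hx : x ⬝ᵥ x ≤ 10)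
    (hy : y ⬝ᵥ y ≤ 10) {l : ℝ} (hl : 0 ≤ l) (hlv : l * v ≤ 1 / 200) :
    ∫⁻ g, ENNReal.ofReal (Real.exp (l * ((x ⬝ᵥ g) * (y ⬝ᵥ g) - (x ⬝ᵥ y) * v))) ∂isoGaussian d v
      ≤ ENNReal.ofReal (Real.exp (1600 * (l * v) ^ 2)) := by
  have hv : (0 : ℝ) ≤ v := v.coe_nonneg
  have quad : ∀ (z : Fin d → ℝ) (a : ℝ), z ⬝ᵥ z ≤ 40 → |a| = l / 2 →
      ∫⁻ g, ENNReal.ofReal (Real.exp (a * ((z ⬝ᵥ g) ^ 2 - z ⬝ᵥ z * v))) ∂isoGaussian d v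
        ≤ ENNReal.ofReal (Real.exp (1600 * (l * v) ^ 2)) := by
    intro z a hz ha
    have hz0 : 0 ≤ z ⬝ᵥ z := Finset.sum_nonneg fun i _ => mul_self_nonneg _
    have hw : (((z ⬝ᵥ z).toNNReal * v : ℝ≥0) : ℝ) = (z ⬝ᵥ z) * v := by
      rw [NNReal.coe_mul, Real.coe_toNNReal _ hz0]
    have h1 : |a| * (z ⬝ᵥ z * v) ≤ 20 * (l * v) := by
      rw [ha]; nlinarith [mul_le_mul_of_nonneg_left hz (mul_nonneg hl hv)]
    rw [← hw, ← lintegral_map (f := fun s : ℝ => ENNReal.ofReal (Real.exp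
      (a * (s ^ 2 - ((z ⬝ᵥ z).toNNReal * v : ℝ≥0))))) (by fun_prop) (measurable_dotProduct_left z),
      isoGaussian_map_dotProduct]
    refine (lintegral_exp_sq_gaussianReal _ _ (by rw [hw]; linarith)).trans ?_
    apply ENNReal.ofReal_le_ofReal
    rw [hw, Real.exp_le_exp, ← sq_abs, abs_mul, abs_of_nonneg (mul_nonneg hz0 hv)]
    have h0 : 0 ≤ |a| * (z ⬝ᵥ z * v) := by positivity
    nlinarith
  have e1 : (x + y) ⬝ᵥ (x + y) = x ⬝ᵥ x + 2 * (x ⬝ᵥ y) + y ⬝ᵥ y := by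
    rw [dotProduct_add, add_dotProduct, add_dotProduct, dotProduct_comm y x]; ring
  have e2 : (x - y) ⬝ᵥ (x - y) = x ⬝ᵥ x - 2 * (x ⬝ᵥ y) + y ⬝ᵥ y := by
    rw [dotProduct_sub, sub_dotProduct, sub_dotProduct, dotProduct_comm y x]; ring
  have p1 : 0 ≤ (x + y) ⬝ᵥ (x + y) := Finset.sum_nonneg fun i _ => mul_self_nonneg _
  have p2 : 0 ≤ (x - y) ⬝ᵥ (x - y) := Finset.sum_nonneg fun i _ => mul_self_nonneg _
  have q1 := quad (x + y) (l / 2) (by linarith) (abs_of_nonneg (by positivity))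
  have q2 := quad (x - y) (-(l / 2)) (by linarith) (by rw [abs_neg, abs_of_nonneg (by positivity)])
  have m1 := measurable_dotProduct_left (x + y)
  have m2 := measurable_dotProduct_left (x - y)
  calc _ ≤ ∫⁻ g, ENNReal.ofReal (1 / 2) *
        (ENNReal.ofReal (Real.exp (l / 2 * (((x + y) ⬝ᵥ g) ^ 2 - (x + y) ⬝ᵥ (x + y) * v)))
        + ENNReal.ofReal (Real.exp (-(l / 2) * (((x - y) ⬝ᵥ g) ^ 2 - (x - y) ⬝ᵥ (x - y) * v))))
        ∂isoGaussian d v := by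
        refine lintegral_mono fun g => ?_
        rw [← ENNReal.ofReal_add (Real.exp_pos _).le (Real.exp_pos _).le,
          ← ENNReal.ofReal_mul (by norm_num)]
        apply ENNReal.ofReal_le_ofReal
        rw [e1, e2, add_dotProduct, sub_dotProduct]
        generalize hp : l / 2 * ((x ⬝ᵥ g + y ⬝ᵥ g) ^ 2 - (x ⬝ᵥ x + 2 * (x ⬝ᵥ y) + y ⬝ᵥ y) * v) = p
        generalize hq : -(l / 2) * ((x ⬝ᵥ g - y ⬝ᵥ g) ^ 2 - (x ⬝ᵥ x - 2 * (x ⬝ᵥ y) + y ⬝ᵥ y) * v) = q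
        have : l * ((x ⬝ᵥ g) * (y ⬝ᵥ g) - (x ⬝ᵥ y) * v) = p / 2 + q / 2 := by
          rw [← hp, ← hq]; ring
        rw [this, Real.exp_add]
        have s1 : Real.exp p = Real.exp (p / 2) ^ 2 := by rw [← Real.exp_nat_mul]; congr 1; push_cast; ring
        have s2 : Real.exp q = Real.exp (q / 2) ^ 2 := by rw [← Real.exp_nat_mul]; congr 1; push_cast; ring
        rw [s1, s2]
        nlinarith [sq_nonneg (Real.exp (p / 2) - Real.exp (q / 2))]
    _ ≤ ENNReal.ofReal (1 / 2) * (ENNReal.ofReal (Real.exp (1600 * (l * v) ^ 2))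
        + ENNReal.ofReal (Real.exp (1600 * (l * v) ^ 2))) := by
        rw [lintegral_const_mul _ (by fun_prop), lintegral_add_left (by fun_prop)]
        gcongr
    _ = _ := by
        rw [← ENNReal.ofReal_add (Real.exp_pos _).le (Real.exp_pos _).le,
          ← ENNReal.ofReal_mul (by norm_num)]
        congr 1
        ring

lemma lintegral_exp_gaussianMatrix_le {k d : ℕ} (hk : k ≠ 0) {x y : Fin d → ℝ} (hx : x ⬝ᵥ x ≤ 10)
    (hy : y ⬝ᵥ y ≤ 10) {l : ℝ} (hl : 0 ≤ l) (hlk : l ≤ k / 200) :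
    ∫⁻ P, ENNReal.ofReal (Real.exp (l * (∑ i, (x ⬝ᵥ P i) * (y ⬝ᵥ P i) - x ⬝ᵥ y))) ∂gaussianMatrix k d
      ≤ ENNReal.ofReal (Real.exp (1600 * l ^ 2 / k)) := by
  have hk' : (0 : ℝ) < k := by positivity
  have hsplit : ∀ P : Fin k → Fin d → ℝ,
      ENNReal.ofReal (Real.exp (l * (∑ i, (x ⬝ᵥ P i) * (y ⬝ᵥ P i) - x ⬝ᵥ y)))
      = ∏ i, ENNReal.ofReal (Real.exp (l * ((x ⬝ᵥ P i) * (y ⬝ᵥ P i)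
        - (x ⬝ᵥ y) * ((k : ℝ≥0)⁻¹ : ℝ≥0)))) := fun P => by
    rw [← ENNReal.ofReal_prod_of_nonneg (fun i _ => (Real.exp_pos _).le), ← Real.exp_sum,
      ← Finset.mul_sum, Finset.sum_sub_distrib]
    congr 4
    simp
    field_simp
  have mx := measurable_dotProduct_left x
  have my := measurable_dotProduct_left y
  simp_rw [hsplit]
  refine (lintegral_pi_prod (fun _ : Fin k => isoGaussian d (k : ℝ≥0)⁻¹)
    (f := fun _ g => ENNReal.ofReal (Real.exp (l * ((x ⬝ᵥ g) * (y ⬝ᵥ g)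
        - (x ⬝ᵥ y) * ((k : ℝ≥0)⁻¹ : ℝ≥0))))) fun i => by fun_prop).trans_le ?_
  refine (Finset.prod_le_prod' fun i _ => lintegral_exp_mul_dotProduct_le hx hy hl ?_).trans ?_
  · push_cast
    rw [← div_eq_mul_inv, div_le_iff₀ hk']
    linarith
  · rw [Finset.prod_const, ← ENNReal.ofReal_pow (Real.exp_pos _).le, ← Real.exp_nat_mul]
    apply le_of_eq
    congr 2
    simp
    field_simp

lemma le_setLIntegral_exp_dotProduct {d n : ℕ} {A : Matrix (Fin d) (Fin n) ℝ} {r : ℝ} (hr : 0 < r)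
    (hA : ∀ u, A *ᵥ u ⬝ᵥ A *ᵥ u ≤ u ⬝ᵥ u) (hf : ∑ i, ∑ j, A i j ^ 2 ≤ r) (w : Fin n → ℝ)
    {u : Fin n → ℝ} (hu : u ⬝ᵥ u ≤ 1) :
    ENNReal.ofReal (3 / 4 * Real.exp (-(r / 2))) * ENNReal.ofReal (Real.exp (w ⬝ᵥ u))
      ≤ ∫⁻ x in {x | A *ᵥ x ⬝ᵥ A *ᵥ x ≤ 10}, ENNReal.ofReal (Real.exp (w ⬝ᵥ x))
        ∂isoGaussian n r.toNNReal⁻¹ := by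
  have hv : ((r.toNNReal⁻¹ : ℝ≥0) : ℝ) = r⁻¹ := by simp [hr.le]
  have hsub : ∀ x ∈ {x : Fin n → ℝ | A *ᵥ x ⬝ᵥ A *ᵥ x ≤ 4},
      x + u ∈ {x : Fin n → ℝ | A *ᵥ x ⬝ᵥ A *ᵥ x ≤ 10} := by
    intro x hx
    have h1 : (A *ᵥ x - A *ᵥ u) ⬝ᵥ (A *ᵥ x - A *ᵥ u) ≥ 0 :=
      Finset.sum_nonneg fun i _ => mul_self_nonneg _
    have h2 := hA u
    simp only [Set.mem_ofPred_eq, Matrix.mulVec_add, dotProduct_add, add_dotProduct, dotProduct_sub,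
      sub_dotProduct] at *
    linarith
  refine le_trans ?_ (le_lintegral_exp_of_shift n (inv_ne_zero (Real.toNNReal_pos.2 hr).ne')
    (measurableSet_le (measurable_mulVec_normSq A) measurable_const)
    (measurableSet_le (measurable_mulVec_normSq A) measurable_const)
    (fun x => by simp [Matrix.mulVec_neg]) u hsub w)
  rw [ENNReal.ofReal_mul (by norm_num), mul_assoc, ← ENNReal.ofReal_mul (Real.exp_pos _).le,
    ← Real.exp_add]
  gcongr
  · apply isoGaussian_mulVec_le
    rw [hv, ← div_eq_mul_inv, div_le_one hr]
    exact hf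
  · have : u ⬝ᵥ u / (2 * ((r.toNNReal⁻¹ : ℝ≥0) : ℝ)) = u ⬝ᵥ u * r / 2 := by
      rw [hv]; field_simp
    rw [this]
    nlinarith

/-- The bilinear form `(x, y) ↦ ⟪P x, P y⟫ - ⟪x, y⟫`. -/
def sketchError {k d : ℕ} (P : Fin k → Fin d → ℝ) (x y : Fin d → ℝ) : ℝ :=
  ∑ i, (x ⬝ᵥ P i) * (y ⬝ᵥ P i) - x ⬝ᵥ y

lemma sketchError_comm {k d : ℕ} (P : Fin k → Fin d → ℝ) (x y : Fin d → ℝ) :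
    sketchError P x y = sketchError P y x := by
  simp only [sketchError, mul_comm, dotProduct_comm x y]

lemma exists_sketchError_eq_dotProduct {k d n : ℕ} (P : Fin k → Fin d → ℝ)
    (A : Matrix (Fin d) (Fin n) ℝ) (l : ℝ) (y : Fin d → ℝ) :
    ∃ w : Fin n → ℝ, ∀ u, l * sketchError P (A *ᵥ u) y = w ⬝ᵥ u := by
  refine ⟨(l • (∑ i, (y ⬝ᵥ P i) • P i - y)) ᵥ* A, fun u => ?_⟩
  rw [← Matrix.dotProduct_mulVec, smul_dotProduct, sub_dotProduct, sum_dotProduct, sketchError,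
    smul_eq_mul, dotProduct_comm y]
  simp only [smul_dotProduct, smul_eq_mul, dotProduct_comm (A *ᵥ u), mul_comm]

lemma gaussianMatrix_sketchError_tail {k d n : ℕ} (hk : k ≠ 0) {A B : Matrix (Fin d) (Fin n) ℝ}
    {r : ℝ} (hr : 0 < r) (hA : ∀ u, A *ᵥ u ⬝ᵥ A *ᵥ u ≤ u ⬝ᵥ u)
    (hB : ∀ u, B *ᵥ u ⬝ᵥ B *ᵥ u ≤ u ⬝ᵥ u) (hfA : ∑ i, ∑ j, A i j ^ 2 ≤ r)
    (hfB : ∑ i, ∑ j, B i j ^ 2 ≤ r) {ε : ℝ} (hε : 0 < ε) (hε1 : ε ≤ 1) :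
    gaussianMatrix k d {P | ∃ u w, u ⬝ᵥ u ≤ 1 ∧ w ⬝ᵥ w ≤ 1 ∧ ε < sketchError P (A *ᵥ u) (B *ᵥ w)}
      ≤ ENNReal.ofReal (16 / 9 * Real.exp (r - ε ^ 2 * k / 6400)) := by
  have hk' : (0 : ℝ) < k := by positivity
  set l : ℝ := ε * k / 3200 with hl
  have hl0 : 0 ≤ l := by positivity
  set SA := {x : Fin n → ℝ | A *ᵥ x ⬝ᵥ A *ᵥ x ≤ 10} with hSA
  set SB := {x : Fin n → ℝ | B *ᵥ x ⬝ᵥ B *ᵥ x ≤ 10} with hSB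
  have mSA : MeasurableSet SA := measurableSet_le (measurable_mulVec_normSq A) measurable_const
  have mSB : MeasurableSet SB := measurableSet_le (measurable_mulVec_normSq B) measurable_const
  set γ := isoGaussian n r.toNNReal⁻¹ with hγ
  set f : (Fin k → Fin d → ℝ) → (Fin n → ℝ) × (Fin n → ℝ) → ℝ≥0∞ := fun P z =>
    ENNReal.ofReal (Real.exp (l * sketchError P (A *ᵥ z.1) (B *ᵥ z.2))) with hf
  have mf : Measurable (Function.uncurry f) := by
    simp only [hf, Function.uncurry_def, sketchError, Matrix.mulVec, dotProduct]
    fun_prop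
  set ν := (γ.restrict SA).prod (γ.restrict SB) with hν
  have lower : ∀ P ∈ {P : Fin k → Fin d → ℝ |
      ∃ u w, u ⬝ᵥ u ≤ 1 ∧ w ⬝ᵥ w ≤ 1 ∧ ε < sketchError P (A *ᵥ u) (B *ᵥ w)},
      ENNReal.ofReal (9 / 16 * Real.exp (l * ε - r)) ≤ ∫⁻ z, f P z ∂ν := by
    rintro P ⟨u, w, hu, hw, huw⟩
    rw [hν, lintegral_prod _ (mf.of_uncurry_left (x := P)).aemeasurable]
    set c := ENNReal.ofReal (3 / 4 * Real.exp (-(r / 2))) with hc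
    have inner : ∀ x, c * ENNReal.ofReal (Real.exp (l * sketchError P (A *ᵥ x) (B *ᵥ w)))
        ≤ ∫⁻ y in SB, f P (x, y) ∂γ := fun x => by
      obtain ⟨p, hp⟩ := exists_sketchError_eq_dotProduct P B l (A *ᵥ x)
      simp only [hf, sketchError_comm P (A *ᵥ x), hp]
      exact le_setLIntegral_exp_dotProduct hr hB hfB p hw
    calc _ ≤ c * (c * ENNReal.ofReal (Real.exp (l * sketchError P (A *ᵥ u) (B *ᵥ w)))) := by
          rw [hc, ← ENNReal.ofReal_mul (by positivity), ← ENNReal.ofReal_mul (by positivity)]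
          apply ENNReal.ofReal_le_ofReal
          have : Real.exp (l * ε - r) = Real.exp (-(r / 2)) * (Real.exp (-(r / 2)) * Real.exp (l * ε)) := by
            rw [← Real.exp_add, ← Real.exp_add]; congr 1; ring
          rw [this]
          have h2 : Real.exp (l * ε) ≤ Real.exp (l * sketchError P (A *ᵥ u) (B *ᵥ w)) := by gcongr
          calc _ = 3 / 4 * Real.exp (-(r / 2)) * (3 / 4 * Real.exp (-(r / 2)) * Real.exp (l * ε)) := by
                ring
            _ ≤ _ := by gcongr
      _ ≤ c * ∫⁻ x in SA, ENNReal.ofReal (Real.exp (l * sketchError P (A *ᵥ x) (B *ᵥ w))) ∂γ := by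
          gcongr
          obtain ⟨p, hp⟩ := exists_sketchError_eq_dotProduct P A l (B *ᵥ w)
          simp only [hp]
          exact le_setLIntegral_exp_dotProduct hr hA hfA p hu
      _ ≤ _ := by
          rw [← lintegral_const_mul' _ _ ENNReal.ofReal_ne_top]
          exact lintegral_mono inner
  have upper : ∫⁻ P, ∫⁻ z, f P z ∂ν ∂gaussianMatrix k d
      ≤ ENNReal.ofReal (Real.exp (1600 * l ^ 2 / k)) := by
    rw [lintegral_lintegral_swap mf.aemeasurable, hν, Measure.prod_restrict]
    calc _ ≤ ∫⁻ z in SA ×ˢ SB, ENNReal.ofReal (Real.exp (1600 * l ^ 2 / k)) ∂γ.prod γ := by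
          refine setLIntegral_mono' (mSA.prod mSB) fun z hz => ?_
          refine lintegral_exp_gaussianMatrix_le hk hz.1 hz.2 hl0 ?_
          rw [hl]
          nlinarith
      _ ≤ _ := by
          rw [setLIntegral_const]
          exact mul_le_of_le_one_right' prob_le_one
  have markov := (mul_meas_ge_le_lintegral (μ := gaussianMatrix k d) mf.lintegral_prod_right
    (ENNReal.ofReal (9 / 16 * Real.exp (l * ε - r)))).trans upper
  have hpos : 0 < 9 / 16 * Real.exp (l * ε - r) := by positivity
  refine (measure_mono lower).trans ?_
  refine (ENNReal.mul_le_mul_iff_right (a := ENNReal.ofReal (9 / 16 * Real.exp (l * ε - r)))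
    (by simpa using hpos) (by simp)).1 (markov.trans ?_)
  rw [← ENNReal.ofReal_mul hpos.le]
  apply ENNReal.ofReal_le_ofReal
  have e : Real.exp (1600 * l ^ 2 / k)
      = Real.exp (l * ε - r) * Real.exp (r - ε ^ 2 * k / 6400) := by
    rw [← Real.exp_add]
    congr 1
    rw [hl]
    field_simp
    ring
  rw [e]
  apply le_of_eq
  ring

lemma norm_toLp_sq {n : ℕ} (u : Fin n → ℝ) : ‖WithLp.toLp 2 u‖ ^ 2 = u ⬝ᵥ u := by
  rw [EuclideanSpace.real_norm_sq_eq]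
  exact Finset.sum_congr rfl fun i _ => sq _

lemma mulVec_normSq_le {m n : ℕ} (A : Matrix (Fin m) (Fin n) ℝ) (u : Fin n → ℝ) :
    A *ᵥ u ⬝ᵥ A *ᵥ u ≤ specNorm A ^ 2 * (u ⬝ᵥ u) := by
  rw [← norm_toLp_sq, ← norm_toLp_sq, ← mul_pow]
  gcongr
  exact (LinearMap.toContinuousLinearMap (Matrix.toEuclideanLin A)).le_opNorm (WithLp.toLp 2 u)

lemma specNorm_le {m n : ℕ} {W : Matrix (Fin m) (Fin n) ℝ} {c : ℝ} (hc : 0 ≤ c)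
    (h : ∀ u w, u ⬝ᵥ u ≤ 1 → w ⬝ᵥ w ≤ 1 → u ⬝ᵥ W *ᵥ w ≤ c) : specNorm W ≤ c := by
  refine ContinuousLinearMap.opNorm_le_of_unit_norm hc fun x hx => ?_
  have hx' : x.ofLp ⬝ᵥ x.ofLp ≤ 1 := by rw [← norm_toLp_sq]; simp [hx]
  change ‖WithLp.toLp 2 (W *ᵥ x.ofLp)‖ ≤ c
  set t := ‖WithLp.toLp 2 (W *ᵥ x.ofLp)‖ with ht
  have ht2 : W *ᵥ x.ofLp ⬝ᵥ W *ᵥ x.ofLp = t ^ 2 := (norm_toLp_sq _).symm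
  clear_value t
  have ht0 : 0 ≤ t := ht ▸ norm_nonneg _
  rcases ht0.eq_or_lt with h0 | h0
  · rw [← h0]; exact hc
  have := h (t⁻¹ • W *ᵥ x.ofLp) x.ofLp (by
    rw [smul_dotProduct, dotProduct_smul, ht2, smul_eq_mul, smul_eq_mul]
    apply le_of_eq; field_simp) hx'
  rw [smul_dotProduct, ht2, smul_eq_mul] at this
  calc t = t⁻¹ * t ^ 2 := by field_simp
    _ ≤ c := this

lemma specNorm_nonneg {m n : ℕ} (A : Matrix (Fin m) (Fin n) ℝ) : 0 ≤ specNorm A := norm_nonneg _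

lemma specNorm_pos {m n : ℕ} {A : Matrix (Fin m) (Fin n) ℝ} (hA : A ≠ 0) : 0 < specNorm A := by
  refine norm_pos_iff.2 ?_
  simpa using hA

lemma frobNorm_sq {m n : ℕ} (A : Matrix (Fin m) (Fin n) ℝ) :
    frobNorm A ^ 2 = ∑ i, ∑ j, A i j ^ 2 :=
  Real.sq_sqrt (Finset.sum_nonneg fun _ _ => Finset.sum_nonneg fun _ _ => sq_nonneg _)

lemma specNorm_le_frobNorm {m n : ℕ} (A : Matrix (Fin m) (Fin n) ℝ) : specNorm A ≤ frobNorm A := by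
  refine ContinuousLinearMap.opNorm_le_bound _ (Real.sqrt_nonneg _) fun x => ?_
  change ‖WithLp.toLp 2 (A *ᵥ x.ofLp)‖ ≤ _
  refine abs_le_of_sq_le_sq' ?_ (mul_nonneg (Real.sqrt_nonneg _) (norm_nonneg _)) |>.2
  rw [norm_toLp_sq, mul_pow]
  change _ ≤ frobNorm A ^ 2 * _
  rw [frobNorm_sq, EuclideanSpace.real_norm_sq_eq, Finset.sum_mul]
  refine Finset.sum_le_sum fun i _ => ?_
  rw [← sq]
  exact Finset.sum_mul_sq_le_sq_mul_sq Finset.univ (fun j => A i j) fun j => x.ofLp j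

lemma dotProduct_sketch_mulVec {k d n : ℕ} (P : Fin k → Fin d → ℝ) (A B : Matrix (Fin d) (Fin n) ℝ)
    (u w : Fin n → ℝ) :
    u ⬝ᵥ ((Matrix.of P * A)ᵀ * (Matrix.of P * B) - Aᵀ * B) *ᵥ w
      = sketchError P (A *ᵥ u) (B *ᵥ w) := by
  have h : ∀ {m : ℕ} (X Y : Matrix (Fin m) (Fin n) ℝ), u ⬝ᵥ (Xᵀ * Y) *ᵥ w = X *ᵥ u ⬝ᵥ Y *ᵥ w := by
    intro m X Y
    rw [← Matrix.mulVec_mulVec, Matrix.dotProduct_mulVec, Matrix.vecMul_transpose]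
  rw [Matrix.sub_mulVec, dotProduct_sub, h, h, sketchError, ← Matrix.mulVec_mulVec,
    ← Matrix.mulVec_mulVec]
  congr 1
  refine Finset.sum_congr rfl fun i _ => ?_
  rw [dotProduct_comm _ (P i), dotProduct_comm _ (P i)]
  rfl

lemma sketchError_smul {k d : ℕ} (P : Fin k → Fin d → ℝ) (a b : ℝ) (x y : Fin d → ℝ) :
    sketchError P (a • x) (b • y) = a * b * sketchError P x y := by
  simp only [sketchError, smul_dotProduct, dotProduct_smul, smul_eq_mul, mul_sub, Finset.mul_sum]
  congr 1
  · exact Finset.sum_congr rfl fun i _ => by ring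
  · ring

theorem stmt15 :
    ∃ C : ℝ, 0 < C ∧
      ∀ (ε δ : ℝ), 0 < ε → ε < 1 → 0 < δ → δ < 1 →
      ∀ (d n k : ℕ) (A B : Matrix (Fin d) (Fin n) ℝ),
        A ≠ 0 → B ≠ 0 →
        C * (max (frobNorm A ^ 2 / specNorm A ^ 2) (frobNorm B ^ 2 / specNorm B ^ 2)
              + Real.log (1 / δ)) / ε ^ 2 ≤ k →
        ENNReal.ofReal (1 - δ) ≤
          gaussianMatrix k d
            {P | specNorm ((Matrix.of P * A)ᵀ * (Matrix.of P * B) - Aᵀ * B) ≤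
                  ε * specNorm A * specNorm B} := by
  refine ⟨12800, by norm_num, fun ε δ hε hε1 hδ hδ1 d n k A B hA hB hk => ?_⟩
  have ha := specNorm_pos hA
  have hb := specNorm_pos hB
  set a := specNorm A with ha_def
  set b := specNorm B with hb_def
  set r := max (frobNorm A ^ 2 / a ^ 2) (frobNorm B ^ 2 / b ^ 2) with hr_def
  have hr1 : 1 ≤ r := by
    refine le_trans ?_ (le_max_left _ _)
    rw [one_le_div (by positivity)]
    exact pow_le_pow_left₀ ha.le (specNorm_le_frobNorm A) 2
  have hlog : 0 < Real.log (1 / δ) := Real.log_pos (by rw [lt_div_iff₀ hδ]; linarith)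
  have hk0 : k ≠ 0 := by
    rintro rfl
    have : 0 < 12800 * (r + Real.log (1 / δ)) / ε ^ 2 := by positivity
    simp only [Nat.cast_zero] at hk
    linarith
  have contract : ∀ X : Matrix (Fin d) (Fin n) ℝ, 0 < specNorm X → ∀ u,
      ((specNorm X)⁻¹ • X) *ᵥ u ⬝ᵥ ((specNorm X)⁻¹ • X) *ᵥ u ≤ u ⬝ᵥ u := by
    intro X hX u
    rw [Matrix.smul_mulVec, smul_dotProduct, dotProduct_smul, smul_eq_mul, smul_eq_mul]
    calc _ ≤ (specNorm X)⁻¹ * ((specNorm X)⁻¹ * (specNorm X ^ 2 * (u ⬝ᵥ u))) := by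
          gcongr
          exact mulVec_normSq_le X u
      _ = _ := by field_simp
  have frob : ∀ X : Matrix (Fin d) (Fin n) ℝ, ∑ i, ∑ j, ((specNorm X)⁻¹ • X) i j ^ 2
      = frobNorm X ^ 2 / specNorm X ^ 2 := by
    intro X
    simp only [frobNorm_sq, Matrix.smul_apply, smul_eq_mul, mul_pow, ← Finset.mul_sum]
    rw [inv_pow, div_eq_inv_mul]
  have tail := gaussianMatrix_sketchError_tail hk0 (A := a⁻¹ • A) (B := b⁻¹ • B) (r := r)
    (by linarith) (contract A ha) (contract B hb) ((frob A).le.trans (le_max_left _ _))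
    ((frob B).le.trans (le_max_right _ _)) hε hε1.le
  have htail : 16 / 9 * Real.exp (r - ε ^ 2 * k / 6400) ≤ δ := by
    rw [div_le_iff₀ (by positivity)] at hk
    calc 16 / 9 * Real.exp (r - ε ^ 2 * k / 6400) ≤ Real.exp r * Real.exp (-r - Real.log (1 / δ)) := by
          refine mul_le_mul ?_ (Real.exp_le_exp.2 (by linarith)) (Real.exp_pos _).le (Real.exp_pos _).le
          linarith [Real.add_one_le_exp r]
      _ = δ := by
          rw [← Real.exp_add, Real.log_div one_ne_zero hδ.ne', Real.log_one]
          ring_nf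
          exact Real.exp_log hδ
  set S := {P : Fin k → Fin d → ℝ | specNorm ((Matrix.of P * A)ᵀ * (Matrix.of P * B) - Aᵀ * B) ≤
    ε * a * b} with hS
  have hSc : gaussianMatrix k d Sᶜ ≤ ENNReal.ofReal δ := by
    refine (measure_mono fun P hP => ?_).trans (tail.trans (ENNReal.ofReal_le_ofReal htail))
    by_contra hcon
    simp only [Set.mem_ofPred_eq, not_exists, not_and, not_lt] at hcon
    refine hP (specNorm_le (by positivity) fun u w hu hw => ?_)
    have h1 := hcon u w hu hw
    rw [Matrix.smul_mulVec, Matrix.smul_mulVec, sketchError_smul, ← mul_inv,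
      inv_mul_le_iff₀ (by positivity)] at h1
    rw [dotProduct_sketch_mulVec]
    linarith
  have h1 : (1 : ℝ≥0∞) ≤ gaussianMatrix k d S + gaussianMatrix k d Sᶜ := by
    rw [← measure_univ (μ := gaussianMatrix k d)]
    exact measure_univ_le_add_compl S
  rw [ENNReal.ofReal_sub _ hδ.le, ENNReal.ofReal_one, tsub_le_iff_right]
  exact h1.trans (by gcongr)
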